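/- Let c_n denote the number of Dyck paths with air pockets of length n ending at height 0. Then the power series ∑ c_n z^n satisfies the algebraic equation: y = s₂ where z y² + (z² − z − 1)y + 1 = 0; equivalently, C(z) = ∑_{n} c_n z^n satisfies z·C(z)² + (z² − z − 1)·C(z) + 1 = 0 as formal power series. -/

import Mathlib

/-- Dyck path with air pockets. -/
def IsDyckAirPocket (l : List ℤ) : Prop :=
  (∀ x ∈ l, x = 1 ∨ x ≤ -1) ∧
  l.Chain' (fun a b => a ≤ -1 → b = 1) ∧
  (∀ p : List ℤ, p <+: l → 0 ≤ p.sum) ∧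
  l.sum = 0

/-- Partial Dyck paths with air pockets (ending at any height) that do not end with a down-step. -/
def IsUpEndingAirPocket (l : List ℤ) : Prop :=
  (∀ x ∈ l, x = 1 ∨ x ≤ -1) ∧
  l.IsChain (fun a b => a ≤ -1 → b = 1) ∧
  (∀ p : List ℤ, p <+: l → 0 ≤ p.sum) ∧
  (∀ x ∈ l.getLast?, x = 1)

theorem List.sum_le_length_of_le_one (l : List ℤ) (h : ∀ x ∈ l, x ≤ 1) : l.sum ≤ l.length := by
  simpa using List.sum_le_card_nsmul l 1 h

theorem List.finite_length_eq_of_forall_mem {α : Type*} {s : Set α} (hs : s.Finite) (n : ℕ) :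
    {l : List α | (∀ x ∈ l, x ∈ s) ∧ l.length = n}.Finite := by
  have := hs.to_subtype
  refine (Set.finite_range fun f : Fin n → s => List.ofFn fun i => (f i : α)).subset ?_
  rintro l ⟨hl, rfl⟩
  exact ⟨fun i => ⟨l.get i, hl _ (l.get_mem i)⟩, List.ofFn_get l⟩

/-- Only finitely many lists of a given length with entries at most `1` have all partial sums
nonnegative. -/
theorem finite_nonneg_prefix_sums (n : ℕ) :
    {l : List ℤ | (∀ x ∈ l, x ≤ 1) ∧ (∀ p : List ℤ, p <+: l → 0 ≤ p.sum) ∧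
      l.length = n}.Finite := by
  refine (List.finite_length_eq_of_forall_mem (Set.finite_Icc (-(n : ℤ)) 1) n).subset ?_
  rintro l ⟨hs, hp, hn⟩
  refine ⟨fun x hx => ⟨?_, hs x hx⟩, hn⟩
  obtain ⟨s, t, rfl⟩ := List.append_of_mem hx
  have h1 := hp (s ++ [x]) ⟨t, by simp⟩
  have h2 := s.sum_le_length_of_le_one fun y hy => hs y (by simp [hy])
  simp at h1 hn
  omega

instance (n : ℕ) : Finite {l : List ℤ // IsDyckAirPocket l ∧ l.length = n} := by
  refine ((finite_nonneg_prefix_sums n).subset ?_).to_subtype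
  rintro l ⟨⟨hs, -, hp, -⟩, hn⟩
  exact ⟨fun x hx => by have := hs x hx; omega, hp, hn⟩

instance (n : ℕ) : Finite {l : List ℤ // IsUpEndingAirPocket l ∧ l.length = n} := by
  refine ((finite_nonneg_prefix_sums n).subset ?_).to_subtype
  rintro l ⟨⟨hs, -, hp, -⟩, hn⟩
  exact ⟨fun x hx => by have := hs x hx; omega, hp, hn⟩

theorem IsUpEndingAirPocket.one_le_sum {l : List ℤ} (h : IsUpEndingAirPocket l) (hl : l ≠ []) :
    1 ≤ l.sum := by
  obtain ⟨-, -, hp, hlast⟩ := h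
  rcases List.eq_nil_or_concat' l with rfl | ⟨q, x, rfl⟩
  · exact absurd rfl hl
  · have h1 := hp q (by simp)
    have h2 := hlast x (by simp)
    simp
    omega

theorem IsUpEndingAirPocket.append_neg_sum {q : List ℤ} (h : IsUpEndingAirPocket q)
    (hq : q ≠ []) : IsDyckAirPocket (q ++ [-q.sum]) := by
  have h1 := h.one_le_sum hq
  obtain ⟨hs, hc, hp, hlast⟩ := h
  refine ⟨?_, ?_, ?_, by simp⟩
  · intro x hx
    rcases List.mem_append.1 hx with hx | hx
    · exact hs x hx
    · simp at hx
      omega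
  · refine List.isChain_append.2 ⟨hc, by simp, ?_⟩
    intro x hx y hy hneg
    have := hlast x hx
    omega
  · intro p hpre
    rcases List.prefix_concat_iff.1 hpre with rfl | hpre
    · simp
    · exact hp p hpre

theorem IsDyckAirPocket.exists_eq_append {l : List ℤ} (h : IsDyckAirPocket l) (hl : l ≠ []) :
    ∃ q, IsUpEndingAirPocket q ∧ q ≠ [] ∧ l = q ++ [-q.sum] := by
  obtain ⟨hs, hc, hp, h0⟩ := h
  rcases List.eq_nil_or_concat' l with rfl | ⟨q, x, rfl⟩
  · exact absurd rfl hl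
  have hq := hp q (by simp)
  have hx := hs x (by simp)
  have hx0 : x = -q.sum := by simp at h0; omega
  obtain ⟨hcq, -, hlast⟩ := List.isChain_append.1 (show List.IsChain _ (q ++ [x]) from hc)
  refine ⟨q, ⟨fun y hy => hs y (by simp [hy]), hcq,
    fun p hpq => hp p (hpq.trans (by simp)), ?_⟩, ?_, by simp [hx0]⟩
  · intro y hy
    have h1 := hlast y hy x (by simp)
    have h2 := hs y (by simp [List.mem_of_getLast? hy])
    omega
  · rintro rfl
    simp at hx0
    omega

theorem card_dyckAirPocket_zero :
    Nat.card {l : List ℤ // IsDyckAirPocket l ∧ l.length = 0} = 1 := by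
  rw [Nat.card_eq_one_iff_exists]
  refine ⟨⟨[], ⟨by simp, List.isChain_nil, by simp, by simp⟩, rfl⟩, ?_⟩
  rintro ⟨l, -, hl⟩
  simpa using hl

theorem card_upEndingAirPocket_zero :
    Nat.card {l : List ℤ // IsUpEndingAirPocket l ∧ l.length = 0} = 1 := by
  rw [Nat.card_eq_one_iff_exists]
  refine ⟨⟨[], by simp [IsUpEndingAirPocket]⟩, ?_⟩
  rintro ⟨l, -, hl⟩
  simpa using hl

theorem card_dyckAirPocket_one :
    Nat.card {l : List ℤ // IsDyckAirPocket l ∧ l.length = 1} = 0 := by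
  have : IsEmpty {l : List ℤ // IsDyckAirPocket l ∧ l.length = 1} := by
    refine ⟨?_⟩
    rintro ⟨l, h, hl⟩
    obtain ⟨x, rfl⟩ := List.length_eq_one_iff.1 hl
    have h1 := h.1 x (by simp)
    have h2 := h.2.2.2
    simp at h2
    omega
  exact Nat.card_of_isEmpty

theorem card_dyckAirPocket_add_two (n : ℕ) :
    Nat.card {l : List ℤ // IsDyckAirPocket l ∧ l.length = n + 2} =
      Nat.card {l : List ℤ // IsUpEndingAirPocket l ∧ l.length = n + 1} := by
  symm
  refine Nat.card_congr (Equiv.ofBijective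
    (fun q => ⟨q.1 ++ [-q.1.sum],
      q.2.1.append_neg_sum (List.ne_nil_of_length_eq_add_one q.2.2), by simp [q.2.2]⟩)
    ⟨?_, ?_⟩)
  · rintro ⟨q, hq⟩ ⟨q', hq'⟩ h
    exact Subtype.ext (List.append_inj_left' (congrArg Subtype.val h) rfl)
  · rintro ⟨l, hl, hn⟩
    obtain ⟨q, hq, -, rfl⟩ := hl.exists_eq_append (List.ne_nil_of_length_eq_add_one hn)
    exact ⟨⟨q, hq, by simpa using hn⟩, rfl⟩

theorem IsDyckAirPocket.append_one_cons {a b : List ℤ} (ha : IsDyckAirPocket a)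
    (hb : IsUpEndingAirPocket b) : IsUpEndingAirPocket (a ++ 1 :: b) := by
  obtain ⟨has, hac, hap, ha0⟩ := ha
  obtain ⟨hbs, hbc, hbp, hbl⟩ := hb
  refine ⟨?_, ?_, ?_, ?_⟩
  · intro x hx
    simp only [List.mem_append, List.mem_cons] at hx
    rcases hx with hx | hx | hx
    · exact has x hx
    · exact Or.inl hx
    · exact hbs x hx
  · refine List.isChain_append.2 ⟨hac, List.isChain_cons.2 ⟨?_, hbc⟩, ?_⟩
    · intro y _ h
      omega
    · simp
  · intro p hp
    rcases List.prefix_or_prefix_of_prefix hp (List.prefix_append a _) with hp' | ⟨t, rfl⟩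
    · exact hap p hp'
    · have ht := (List.prefix_append_right_inj a).1 hp
      rcases List.prefix_cons_iff.1 ht with rfl | ⟨u, rfl, hu⟩
      · simp [ha0]
      · have := hbp u hu
        simp [ha0]
        omega
  · rcases List.eq_nil_or_concat' b with rfl | ⟨q, y, rfl⟩
    · simp
    · rw [show a ++ 1 :: (q ++ [y]) = a ++ 1 :: q ++ [y] by simp, List.getLast?_concat]
      rwa [List.getLast?_concat] at hbl

theorem append_one_cons_inj_of_nonneg {a a' b b' : List ℤ} (ha : a.sum = 0) (ha' : a'.sum = 0)
    (hb : ∀ p : List ℤ, p <+: b → 0 ≤ p.sum) (hb' : ∀ p : List ℤ, p <+: b' → 0 ≤ p.sum)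
    (h : a ++ 1 :: b = a' ++ 1 :: b') : a = a' ∧ b = b' := by
  have key : ∀ {a t b b' : List ℤ}, a.sum = 0 → (a ++ t).sum = 0 →
      (∀ p : List ℤ, p <+: b → 0 ≤ p.sum) → 1 :: b = t ++ 1 :: b' → t = [] := by
    intro a t b b' ha hat hb h
    cases t with
    | nil => rfl
    | cons x t =>
      simp only [List.cons_append, List.cons.injEq] at h
      obtain ⟨rfl, rfl⟩ := h
      have := hb t (by simp)
      simp [ha] at hat
      omega
  rcases List.append_eq_append_iff.1 h with ⟨t, rfl, ht⟩ | ⟨t, rfl, ht⟩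
  · obtain rfl := key ha ha' hb ht
    simpa using ht
  · obtain rfl := key ha' ha hb' ht
    simpa [eq_comm] using ht

/-- Splitting a nonnegative path of positive final height at its last visit to height `0`. -/
theorem exists_eq_append_one_cons (l : List ℤ) (hs : ∀ x ∈ l, x ≤ 1)
    (hp : ∀ p : List ℤ, p <+: l → 0 ≤ p.sum) (hl : 1 ≤ l.sum) :
    ∃ a b : List ℤ, l = a ++ 1 :: b ∧ a.sum = 0 ∧ ∀ p : List ℤ, p <+: b → 0 ≤ p.sum := by
  induction l using List.reverseRecOn with
  | nil => simp at hl
  | append_singleton q x ih =>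
    have hq := hp q (by simp)
    have hx := hs x (by simp)
    simp at hl
    by_cases h : 1 ≤ q.sum
    · obtain ⟨a, b, rfl, ha, hb⟩ := ih (fun y hy => hs y (by simp [hy]))
        (fun p h => hp p (h.trans (by simp))) h
      refine ⟨a, b ++ [x], by simp, ha, fun p hpb => ?_⟩
      rcases List.prefix_concat_iff.1 hpb with rfl | hpb
      · simp [ha] at hl ⊢
        omega
      · exact hb p hpb
    · refine ⟨q, [], ?_, by omega, by simp⟩
      have : x = 1 := by omega
      simp [this]

theorem IsUpEndingAirPocket.exists_eq_append_one_cons {l : List ℤ} (h : IsUpEndingAirPocket l)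
    (hl : l ≠ []) :
    ∃ a b, IsDyckAirPocket a ∧ IsUpEndingAirPocket b ∧ l = a ++ 1 :: b := by
  have hsum := h.one_le_sum hl
  obtain ⟨hs, hc, hp, hlast⟩ := h
  obtain ⟨a, b, rfl, ha, hb⟩ := _root_.exists_eq_append_one_cons l
    (fun x hx => by have := hs x hx; omega) hp hsum
  obtain ⟨hca, hcb, -⟩ := List.isChain_append.1 hc
  refine ⟨a, b, ⟨fun x hx => hs x (by simp [hx]), hca,
    fun p h => hp p (h.trans (by simp)), ha⟩, ⟨fun x hx => hs x (by simp [hx]),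
    (List.isChain_cons.1 hcb).2, hb, ?_⟩, rfl⟩
  rcases List.eq_nil_or_concat' b with rfl | ⟨q, y, rfl⟩
  · simp
  · rw [show a ++ 1 :: (q ++ [y]) = a ++ 1 :: q ++ [y] by simp, List.getLast?_concat] at hlast
    rwa [List.getLast?_concat]

theorem card_upEndingAirPocket_succ (n : ℕ) :
    Nat.card {l : List ℤ // IsUpEndingAirPocket l ∧ l.length = n + 1} =
      ∑ p ∈ Finset.HasAntidiagonal.antidiagonal n,
        Nat.card {l : List ℤ // IsDyckAirPocket l ∧ l.length = p.1} *
          Nat.card {l : List ℤ // IsUpEndingAirPocket l ∧ l.length = p.2} := by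
  have e : (Σ p : Finset.HasAntidiagonal.antidiagonal n,
      {l : List ℤ // IsDyckAirPocket l ∧ l.length = p.1.1} ×
        {l : List ℤ // IsUpEndingAirPocket l ∧ l.length = p.1.2}) ≃
      {l : List ℤ // IsUpEndingAirPocket l ∧ l.length = n + 1} := by
    refine Equiv.ofBijective (fun s => ⟨s.2.1.1 ++ 1 :: s.2.2.1,
      s.2.1.2.1.append_one_cons s.2.2.2.1, ?_⟩) ⟨?_, ?_⟩
    · have := Finset.HasAntidiagonal.mem_antidiagonal.1 s.1.2
      simp [s.2.1.2.2, s.2.2.2.2]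
      omega
    · rintro ⟨⟨⟨i, j⟩, hij⟩, ⟨a, ha, hi⟩, ⟨b, hb, hj⟩⟩
        ⟨⟨⟨i', j'⟩, hij'⟩, ⟨a', ha', hi'⟩, ⟨b', hb', hj'⟩⟩ h
      obtain ⟨rfl, rfl⟩ := append_one_cons_inj_of_nonneg ha.2.2.2 ha'.2.2.2 hb.2.2.1 hb'.2.2.1
        (congrArg Subtype.val h)
      dsimp only at hi hj hi' hj'
      subst hi hj hi' hj'
      rfl
    · rintro ⟨l, hl, hn⟩
      obtain ⟨a, b, ha, hb, rfl⟩ :=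
        hl.exists_eq_append_one_cons (List.ne_nil_of_length_eq_add_one hn)
      refine ⟨⟨⟨(a.length, b.length), ?_⟩, ⟨a, ha, rfl⟩, ⟨b, hb, rfl⟩⟩, rfl⟩
      simp at hn ⊢
      omega
  rw [← Nat.card_congr e, Nat.card_sigma]
  simp only [Nat.card_prod]
  exact Finset.sum_coe_sort (Finset.HasAntidiagonal.antidiagonal n) fun p =>
    Nat.card {l : List ℤ // IsDyckAirPocket l ∧ l.length = p.1} *
      Nat.card {l : List ℤ // IsUpEndingAirPocket l ∧ l.length = p.2}

open PowerSeries in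
/-- the counting series C(z) = ∑ c_n z^n of Dyck paths with air
pockets satisfies z C² + (z² − z − 1) C + 1 = 0 as formal power series. -/
theorem stmt15
    (C : PowerSeries ℚ)
    (hC : C = PowerSeries.mk
      (fun n => (Nat.card {l : List ℤ // IsDyckAirPocket l ∧ l.length = n} : ℚ))) :
    X * C ^ 2 + (X ^ 2 - X - 1) * C + 1 = 0 := by
  let E : PowerSeries ℚ := PowerSeries.mk
    (fun n => (Nat.card {l : List ℤ // IsUpEndingAirPocket l ∧ l.length = n} : ℚ))
  have hE : E = 1 + X * (C * E) := by
    ext (_ | n)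
    · simpa [E] using card_upEndingAirPocket_zero
    · rw [map_add, coeff_succ_X_mul, coeff_mul]
      simp [E, hC, coeff_one, card_upEndingAirPocket_succ]
  have hCE : C = 1 + X * (E - 1) := by
    have hE0 : constantCoeff E = 1 := by
      rw [hE]
      simp
    ext (_ | _ | n)
    · simpa [hC] using card_dyckAirPocket_zero
    · rw [map_add, coeff_succ_X_mul]
      simp [hE0, hC, coeff_one, card_dyckAirPocket_one]
    · rw [map_add, coeff_succ_X_mul]
      simp [E, hC, coeff_one, card_dyckAirPocket_add_two]
  linear_combination (-X) * hE + (X * C - 1) * hCE
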